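/- There exist constants C > 0 and C' > 0 such that for every n ≥ 2 and every connected initial graph G₀ on n vertices, after T = ⌈C·n·(ln n)²⌉ rounds of the two-hop walk process, the graph G_T is the complete graph on V with probability at least 1 − C'·(ln n)/n. -/

import Mathlib

open scoped Classical

noncomputable section

variable {V : Type} [Fintype V] [DecidableEq V]

/-- The neighbors of `v` in `G`, as a `Finset`. -/
def nbr (G : SimpleGraph V) (v : V) : Finset V := Finset.univ.filter (fun w => G.Adj v w)

/-- The degree `d(v)` of `v` in `G`. -/
def deg (G : SimpleGraph V) (v : V) : ℕ := (nbr G v).card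

/-- The minimum degree of `G`. -/
def minDeg (G : SimpleGraph V) : ℕ := sInf (Set.range (deg G))

/-- `Nk G u i` is the set `Nⁱ(u)` of vertices at graph distance exactly `i` from `u`. -/
def Nk (G : SimpleGraph V) (u : V) (i : ℕ) : Finset V :=
  Finset.univ.filter (fun v => v ≠ u ∧ G.dist u v = i)

/-- `degIn G v S` is `d(v, S)`, the number of neighbors of `v` lying in `S`. -/
def degIn (G : SimpleGraph V) (v : V) (S : Finset V) : ℕ := (nbr G v ∩ S).card

/-- The graph obtained from a choice function `c` in one round of the triangulation
process: every vertex `w` adds the edge joining the ordered pair `c w` of its chosen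
neighbors (edges are unordered, loops are discarded, all additions are simultaneous). -/
def triNext (G : SimpleGraph V) (c : V → V × V) : SimpleGraph V :=
  G ⊔ SimpleGraph.fromEdgeSet {e | ∃ v : V, e = s((c v).1, (c v).2)}

/-- The probability that in one round of the triangulation process on the current
graph `G` the vertices make exactly the choices recorded by `c`: each vertex with at
least one neighbor independently picks an ordered pair of its neighbors uniformly at
random with replacement; isolated vertices are given the dummy choice `(v, v)`. -/
def triWeight (G : SimpleGraph V) (c : V → V × V) : ℝ :=
  ∏ v : V,
    if deg G v = 0 then (if c v = (v, v) then 1 else 0)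
    else if (c v).1 ∈ nbr G v ∧ (c v).2 ∈ nbr G v then (1 : ℝ) / (deg G v : ℝ) ^ 2 else 0

/-- Transition probability of one round of the triangulation process. -/
def triStep (G G' : SimpleGraph V) : ℝ :=
  ∑ c : V → V × V, if triNext G c = G' then triWeight G c else 0

/-- The graph obtained from a choice function `c` in one round of the two-hop walk
process: every vertex `u` adds the edge to the endpoint `(c u).2` of its two-hop walk
(loops are discarded, all additions are simultaneous). -/
def hopNext (G : SimpleGraph V) (c : V → V × V) : SimpleGraph V :=
  G ⊔ SimpleGraph.fromEdgeSet {e | ∃ u : V, e = s(u, (c u).2)}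

/-- The probability that in one round of the two-hop walk process on the current graph
`G` the vertices make exactly the choices recorded by `c`: each vertex `u` with at
least one neighbor independently picks a uniformly random neighbor `v = (c u).1` and
then a uniformly random neighbor `w = (c u).2` of `v`; isolated vertices are given the
dummy choice `(u, u)`. -/
def hopWeight (G : SimpleGraph V) (c : V → V × V) : ℝ :=
  ∏ u : V,
    if deg G u = 0 then (if c u = (u, u) then 1 else 0)
    else if (c u).1 ∈ nbr G u ∧ (c u).2 ∈ nbr G (c u).1
      then (1 : ℝ) / ((deg G u : ℝ) * (deg G (c u).1 : ℝ)) else 0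

/-- Transition probability of one round of the two-hop walk process. -/
def hopStep (G G' : SimpleGraph V) : ℝ :=
  ∑ c : V → V × V, if hopNext G c = G' then hopWeight G c else 0

/-- `trajProb step g0 T E` is the probability, for the Markov chain on a finite state
space `Γ` with one-step transition probabilities `step` started at `g0`, that the
trajectory `(g_0, g_1, …, g_T)` satisfies the event `E`; probabilities are realized as
a probability mass function on finite sequences of states.  (The trajectory is passed
to `E` as a function on `ℕ`, frozen at time `T`.) -/
def trajProb {Γ : Type} [Fintype Γ] (step : Γ → Γ → ℝ) (g0 : Γ) (T : ℕ)
    (E : (ℕ → Γ) → Prop) : ℝ :=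
  ∑ s : Fin (T + 1) → Γ,
    if s 0 = g0 ∧ E (fun t => s ⟨min t T, Nat.lt_succ_of_le (Nat.min_le_right t T)⟩)
    then ∏ t : Fin T, step (s t.castSucc) (s t.succ) else 0

end

section

set_option linter.unusedSectionVars false

variable {V : Type} [Fintype V] [DecidableEq V]

/-- The expectation of `f` after `t` rounds of the two-hop walk process started at `G`. -/
noncomputable def hopExp : ℕ → (SimpleGraph V → ℝ) → SimpleGraph V → ℝ
  | 0, f, G => f G
  | t + 1, f, G => ∑ G', hopStep G G' * hopExp t f G'

/-- The indicator function of a predicate. -/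
noncomputable def indic {α : Type} (E : α → Prop) (a : α) : ℝ := if E a then 1 else 0

theorem indic_of {α : Type} {E : α → Prop} {a : α} (h : E a) : indic E a = 1 := if_pos h

theorem indic_of_not {α : Type} {E : α → Prop} {a : α} (h : ¬ E a) : indic E a = 0 := if_neg h

theorem indic_nonneg {α : Type} (E : α → Prop) (a : α) : 0 ≤ indic E a := by
  unfold indic; split_ifs <;> norm_num

theorem indic_le_one {α : Type} (E : α → Prop) (a : α) : indic E a ≤ 1 := by
  unfold indic; split_ifs <;> norm_num

theorem mem_nbr {G : SimpleGraph V} {v w : V} : w ∈ nbr G v ↔ G.Adj v w := by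
  simp [nbr]

theorem nbr_mono {G G' : SimpleGraph V} (h : G ≤ G') (v : V) : nbr G v ⊆ nbr G' v :=
  fun _ hw => mem_nbr.2 (h (mem_nbr.1 hw))

theorem deg_mono {G G' : SimpleGraph V} (h : G ≤ G') (v : V) : deg G v ≤ deg G' v :=
  Finset.card_le_card (nbr_mono h v)

theorem deg_pos_of_adj {G : SimpleGraph V} {v w : V} (h : G.Adj v w) : 0 < deg G v :=
  Finset.card_pos.2 ⟨w, mem_nbr.2 h⟩

theorem insert_nbr_card (G : SimpleGraph V) (v : V) : (insert v (nbr G v)).card = deg G v + 1 :=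
  Finset.card_insert_of_notMem fun h => G.loopless.irrefl v (mem_nbr.1 h)

theorem deg_lt_card (G : SimpleGraph V) (v : V) : deg G v + 1 ≤ Fintype.card V := by
  rw [← insert_nbr_card]; exact Finset.card_le_univ _

/-- The probability that `u` makes the choice `p` in one round from `G`. -/
noncomputable def choiceWeight (G : SimpleGraph V) (u : V) (p : V × V) : ℝ :=
  if deg G u = 0 then (if p = (u, u) then 1 else 0)
  else if p.1 ∈ nbr G u ∧ p.2 ∈ nbr G p.1
    then (1 : ℝ) / ((deg G u : ℝ) * (deg G p.1 : ℝ)) else 0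

theorem hopWeight_eq (G : SimpleGraph V) (c : V → V × V) :
    hopWeight G c = ∏ u, choiceWeight G u (c u) := by
  unfold hopWeight choiceWeight
  refine Finset.prod_congr rfl fun u _ => ?_
  congr

theorem choiceWeight_nonneg (G : SimpleGraph V) (u : V) (p : V × V) :
    0 ≤ choiceWeight G u p := by
  unfold choiceWeight; split_ifs <;> positivity

theorem hopWeight_nonneg (G : SimpleGraph V) (c : V → V × V) : 0 ≤ hopWeight G c := by
  rw [hopWeight_eq]; exact Finset.prod_nonneg fun u _ => choiceWeight_nonneg G u _

theorem sum_choiceWeight_of_deg_ne_zero {G : SimpleGraph V} {u : V} (hu : deg G u ≠ 0)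
    (f : V × V → ℝ) :
    ∑ p, choiceWeight G u p * f p =
      ∑ v ∈ nbr G u, ∑ w ∈ nbr G v, 1 / ((deg G u : ℝ) * deg G v) * f (v, w) := by
  rw [Fintype.sum_prod_type]
  rw [← Finset.sum_subset (Finset.subset_univ (nbr G u))]
  · refine Finset.sum_congr rfl fun v hv => ?_
    rw [← Finset.sum_subset (Finset.subset_univ (nbr G v))]
    · refine Finset.sum_congr rfl fun w hw => ?_
      simp [choiceWeight, hu, hv, hw]
    · intro w _ hw
      simp [choiceWeight, hu, hw]
  · intro v _ hv
    refine Finset.sum_eq_zero fun w _ => ?_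
    simp [choiceWeight, hu, hv]

theorem sum_choiceWeight (G : SimpleGraph V) (u : V) : ∑ p, choiceWeight G u p = 1 := by
  by_cases hu : deg G u = 0
  · simp [choiceWeight, hu]
  · have h := sum_choiceWeight_of_deg_ne_zero hu (fun _ => 1)
    simp only [mul_one] at h
    rw [h]
    have hu' : (deg G u : ℝ) ≠ 0 := by exact_mod_cast hu
    have : ∀ v ∈ nbr G u, ∑ w ∈ nbr G v, 1 / ((deg G u : ℝ) * deg G v) = 1 / (deg G u : ℝ) := by
      intro v hv
      have hv' : (deg G v : ℝ) ≠ 0 := by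
        exact_mod_cast (deg_pos_of_adj (mem_nbr.1 hv).symm).ne'
      rw [Finset.sum_const, nsmul_eq_mul]
      change (deg G v : ℝ) * _ = _
      field_simp
    rw [Finset.sum_congr rfl this, Finset.sum_const, nsmul_eq_mul]
    change (deg G u : ℝ) * _ = _
    field_simp

/-- The marginal of one round at a single vertex. -/
theorem sum_hopWeight_mul (G : SimpleGraph V) (x : V) (f : V × V → ℝ) :
    ∑ c : V → V × V, hopWeight G c * f (c x) = ∑ p, choiceWeight G x p * f p := by
  have h := Finset.prod_univ_sum (fun _ : V => (Finset.univ : Finset (V × V)))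
    (fun u p => choiceWeight G u p * if u = x then f p else 1)
  rw [Fintype.piFinset_univ] at h
  calc ∑ c : V → V × V, hopWeight G c * f (c x)
      = ∑ c : V → V × V, ∏ u, (choiceWeight G u (c u) * if u = x then f (c u) else 1) := by
        refine Finset.sum_congr rfl fun c _ => ?_
        rw [Finset.prod_mul_distrib, ← hopWeight_eq, Finset.prod_ite_eq']
        simp
    _ = ∏ u, ∑ p, (choiceWeight G u p * if u = x then f p else 1) := h.symm
    _ = ∑ p, choiceWeight G x p * f p := by
        rw [Finset.prod_eq_single x]
        · simp
        · intro u _ hu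
          simp [hu, sum_choiceWeight]
        · simp

theorem sum_hopWeight (G : SimpleGraph V) [Nonempty V] : ∑ c, hopWeight G c = 1 := by
  have h := sum_hopWeight_mul G (Classical.arbitrary V) (fun _ => 1)
  simpa [sum_choiceWeight] using h

theorem le_hopNext (G : SimpleGraph V) (c : V → V × V) : G ≤ hopNext G c := le_sup_left

theorem hopStep_nonneg (G G' : SimpleGraph V) : 0 ≤ hopStep G G' := by
  refine Finset.sum_nonneg fun c _ => ?_
  split_ifs
  · exact hopWeight_nonneg G c
  · exact le_rfl

theorem hopStep_eq_zero {G G' : SimpleGraph V} (h : ¬ G ≤ G') : hopStep G G' = 0 := by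
  refine Finset.sum_eq_zero fun c _ => if_neg ?_
  rintro rfl
  exact h (le_hopNext G c)

theorem sum_hopStep_mul (G : SimpleGraph V) (f : SimpleGraph V → ℝ) :
    ∑ G', hopStep G G' * f G' = ∑ c, hopWeight G c * f (hopNext G c) := by
  simp only [hopStep, Finset.sum_mul]
  rw [Finset.sum_comm]
  refine Finset.sum_congr rfl fun c _ => ?_
  simp [ite_mul]

theorem hopExp_mono_fun {f g : SimpleGraph V → ℝ} (t : ℕ) (G : SimpleGraph V)
    (h : ∀ G', G ≤ G' → f G' ≤ g G') : hopExp t f G ≤ hopExp t g G := by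
  induction t generalizing G with
  | zero => exact h G le_rfl
  | succ t ih =>
    refine Finset.sum_le_sum fun G' _ => ?_
    by_cases hG : G ≤ G'
    · exact mul_le_mul_of_nonneg_left (ih G' fun H hH => h H (hG.trans hH)) (hopStep_nonneg _ _)
    · simp [hopStep_eq_zero hG]

theorem hopExp_const [Nonempty V] (t : ℕ) (a : ℝ) (G : SimpleGraph V) :
    hopExp t (fun _ => a) G = a := by
  induction t generalizing G with
  | zero => rfl
  | succ t ih =>
    simp only [hopExp, ih]
    rw [sum_hopStep_mul G (fun _ => a), ← Finset.sum_mul, sum_hopWeight, one_mul]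

theorem hopExp_add_fun (t : ℕ) (f g : SimpleGraph V → ℝ) (G : SimpleGraph V) :
    hopExp t (fun H => f H + g H) G = hopExp t f G + hopExp t g G := by
  induction t generalizing G with
  | zero => rfl
  | succ t ih => simp only [hopExp, ih, mul_add, Finset.sum_add_distrib]

theorem hopExp_const_mul (t : ℕ) (a : ℝ) (f : SimpleGraph V → ℝ) (G : SimpleGraph V) :
    hopExp t (fun H => a * f H) G = a * hopExp t f G := by
  induction t generalizing G with
  | zero => rfl
  | succ t ih =>
    simp only [hopExp, ih, Finset.mul_sum]
    exact Finset.sum_congr rfl fun _ _ => by ring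

theorem hopExp_sum {ι : Type} [Nonempty V] (t : ℕ) (s : Finset ι) (f : ι → SimpleGraph V → ℝ)
    (G : SimpleGraph V) :
    hopExp t (fun H => ∑ i ∈ s, f i H) G = ∑ i ∈ s, hopExp t (f i) G := by
  induction s using Finset.induction_on with
  | empty => simpa using hopExp_const t 0 G
  | insert i s hi ih => simp only [Finset.sum_insert hi, hopExp_add_fun, ih]

theorem hopExp_add (a b : ℕ) (f : SimpleGraph V → ℝ) (G : SimpleGraph V) :
    hopExp (a + b) f G = hopExp a (hopExp b f) G := by
  induction a generalizing G with
  | zero => simp [hopExp]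
  | succ a ih => rw [Nat.succ_add]; simp only [hopExp, ih]

theorem hopExp_indic_le_one [Nonempty V] (t : ℕ) (E : SimpleGraph V → Prop)
    (G : SimpleGraph V) : hopExp t (indic E) G ≤ 1 :=
  (hopExp_mono_fun t G fun H _ => indic_le_one E H).trans_eq (hopExp_const t 1 G)

theorem hopExp_indic_of_forall_not [Nonempty V] {E : SimpleGraph V → Prop} {G : SimpleGraph V}
    (t : ℕ) (h : ∀ H, G ≤ H → ¬ E H) : hopExp t (indic E) G ≤ 0 :=
  (hopExp_mono_fun t G fun H hH => (indic_of_not (h H hH)).le).trans_eq (hopExp_const t 0 G)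

/-- Sequential composition of failure bounds. -/
theorem hopExp_indic_comp [Nonempty V] {E F : SimpleGraph V → Prop} {G : SimpleGraph V}
    {a b : ℕ} {ε η : ℝ} (hη : 0 ≤ η) (h₁ : hopExp a (indic E) G ≤ ε)
    (h₂ : ∀ H, G ≤ H → ¬ E H → hopExp b (indic F) H ≤ η) :
    hopExp (a + b) (indic F) G ≤ ε + η := by
  rw [hopExp_add]
  calc hopExp a (hopExp b (indic F)) G ≤ hopExp a (fun H => indic E H + η) G := by
        refine hopExp_mono_fun a G fun H hH => ?_
        by_cases hE : E H
        · rw [indic_of hE]; linarith [hopExp_indic_le_one b F H]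
        · rw [indic_of_not hE, zero_add]; exact h₂ H hH hE
    _ = hopExp a (indic E) G + η := by rw [hopExp_add_fun, hopExp_const]
    _ ≤ ε + η := by linarith

/-- Union bound. -/
theorem hopExp_indic_exists_le [Nonempty V] {ι : Type} {s : Finset ι}
    {E : ι → SimpleGraph V → Prop} {G : SimpleGraph V} {t : ℕ} {ε : ℝ}
    (h : ∀ i ∈ s, hopExp t (indic (E i)) G ≤ ε) :
    hopExp t (indic fun H => ∃ i ∈ s, E i H) G ≤ s.card * ε := by
  calc hopExp t (indic fun H => ∃ i ∈ s, E i H) G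
      ≤ hopExp t (fun H => ∑ i ∈ s, indic (E i) H) G := by
        refine hopExp_mono_fun t G fun H _ => ?_
        by_cases hE : ∃ i ∈ s, E i H
        · rw [indic_of (E := fun H => ∃ i ∈ s, E i H) hE]
          obtain ⟨i, hi, hEi⟩ := hE
          rw [← indic_of hEi]
          exact Finset.single_le_sum (f := fun i => indic (E i) H)
            (fun j _ => indic_nonneg _ _) hi
        · rw [indic_of_not (E := fun H => ∃ i ∈ s, E i H) hE]
          exact Finset.sum_nonneg fun j _ => indic_nonneg _ _
    _ = ∑ i ∈ s, hopExp t (indic (E i)) G := hopExp_sum _ _ _ _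
    _ ≤ s.card * ε := by
        rw [← nsmul_eq_mul]; exact Finset.sum_le_card_nsmul _ _ _ h

/-- If, as long as `Q` holds, the counter `k` increases (or `Q` fails) in the next round with
probability at least `ρ * k`, then `Q` survives `t` rounds with exponentially small probability. -/
theorem hopExp_indic_decay [Nonempty V] {Q : SimpleGraph V → Prop} {k : SimpleGraph V → ℕ}
    {G₀ : SimpleGraph V} {ρ N : ℝ} (hρ : 0 ≤ ρ) (hρ' : ρ ≤ 1) (hN : 0 ≤ N)
    (hQ : ∀ G H, G ≤ H → Q H → Q G) (hk : ∀ G H, G ≤ H → k G ≤ k H)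
    (hk₀ : 1 ≤ k G₀) (hkN : ∀ G, (k G : ℝ) ≤ N)
    (hstep : ∀ G, G₀ ≤ G → Q G →
      ρ * k G ≤ hopExp 1 (indic fun H => ¬ (Q H ∧ k H = k G)) G) (t : ℕ) :
    hopExp t (indic Q) G₀ ≤ N * (1 - ρ / 2) ^ t := by
  have hk1 : ∀ G, G₀ ≤ G → (1 : ℝ) ≤ k G := fun G hG => by exact_mod_cast hk₀.trans (hk _ _ hG)
  have key : ∀ (t : ℕ) (G), G₀ ≤ G →
      hopExp t (fun H => indic Q H / k H) G ≤ (1 - ρ / 2) ^ t * (indic Q G / k G) := by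
    intro t
    induction t with
    | zero => intro G _; simp [hopExp]
    | succ t ih =>
      intro G hG
      rw [add_comm t 1, hopExp_add, pow_add, pow_one]
      have h1 : hopExp 1 (hopExp t (fun H => indic Q H / k H)) G
          ≤ (1 - ρ / 2) ^ t * hopExp 1 (fun H => indic Q H / k H) G := by
        rw [← hopExp_const_mul]
        exact hopExp_mono_fun 1 G fun H hH => ih H (hG.trans hH)
      refine h1.trans ?_
      have hp : 0 ≤ (1 - ρ / 2) ^ t := pow_nonneg (by linarith) t
      rw [mul_comm (1 - ρ / 2), mul_assoc]
      refine mul_le_mul_of_nonneg_left ?_ hp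
      by_cases hQG : Q G
      · have hkG := hk1 G hG
        set κ : ℝ := (k G : ℝ) with hκ
        have hκ0 : 0 < κ := by linarith
        have h2 : hopExp 1 (fun H => indic Q H / k H) G ≤
            hopExp 1 (fun H => 1 / κ +
              (-(1 / (κ * (κ + 1)))) * indic (fun H => ¬ (Q H ∧ k H = k G)) H) G := by
          refine hopExp_mono_fun 1 G fun H hH => ?_
          by_cases hE : Q H ∧ k H = k G
          · rw [indic_of hE.1,
              indic_of_not (E := fun H => ¬ (Q H ∧ k H = k G)) (not_not.2 hE), hE.2, mul_zero, add_zero]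
          · rw [indic_of (E := fun H => ¬ (Q H ∧ k H = k G)) hE, mul_one]
            have h3 : 1 / κ + -(1 / (κ * (κ + 1))) = 1 / (κ + 1) := by
              field_simp; ring
            rw [h3]
            by_cases hQH : Q H
            · rw [indic_of hQH]
              have hlt : k G + 1 ≤ k H :=
                lt_of_le_of_ne (hk _ _ hH) fun h => hE ⟨hQH, h.symm⟩
              have hlt' : κ + 1 ≤ k H := by rw [hκ]; exact_mod_cast hlt
              exact one_div_le_one_div_of_le (by linarith) hlt'
            · rw [indic_of_not hQH, zero_div]; positivity
        refine h2.trans ?_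
        rw [hopExp_add_fun, hopExp_const, hopExp_const_mul, indic_of hQG]
        have h4 := hstep G hG hQG
        have h5 : 1 / (κ * (κ + 1)) * (ρ * κ) ≤ 1 / (κ * (κ + 1)) *
            hopExp 1 (indic fun H => ¬ (Q H ∧ k H = k G)) G :=
          mul_le_mul_of_nonneg_left h4 (by positivity)
        have h6 : ρ / 2 * (1 / κ) ≤ 1 / (κ * (κ + 1)) * (ρ * κ) := by
          rw [div_mul_div_comm, div_mul_eq_mul_div, div_le_div_iff₀ (by positivity) (by positivity)]
          have : 0 ≤ ρ * κ ^ 2 * (κ - 1) := by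
            have : 0 ≤ κ - 1 := by linarith
            positivity
          nlinarith [this]
        linarith
      · have : ∀ H, G ≤ H → indic Q H / (k H : ℝ) ≤ 0 := fun H hH => by
          rw [indic_of_not fun h => hQG (hQ _ _ hH h), zero_div]
        rw [indic_of_not hQG, zero_div, mul_zero]
        exact (hopExp_mono_fun 1 G this).trans_eq (hopExp_const 1 0 G)
  have hp : 0 ≤ (1 - ρ / 2) ^ t := pow_nonneg (by linarith) t
  calc hopExp t (indic Q) G₀ ≤ hopExp t (fun H => N * (indic Q H / k H)) G₀ := by
        refine hopExp_mono_fun t G₀ fun H hH => ?_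
        have h1 := hk1 H hH
        rw [mul_div_assoc', le_div_iff₀ (by linarith), mul_comm]
        exact mul_le_mul_of_nonneg_right (hkN H) (indic_nonneg _ _)
    _ = N * hopExp t (fun H => indic Q H / k H) G₀ := hopExp_const_mul _ _ _ _
    _ ≤ N * ((1 - ρ / 2) ^ t * 1) := by
        refine mul_le_mul_of_nonneg_left ((key t G₀ le_rfl).trans
          (mul_le_mul_of_nonneg_left ?_ hp)) hN
        have h1 := hk1 G₀ le_rfl
        rw [div_le_one (by linarith)]
        exact (indic_le_one Q G₀).trans h1
    _ = N * (1 - ρ / 2) ^ t := by rw [mul_one]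

/-- Lower bound for the probability that the walk of `x` ends in `R`. -/
theorem le_hopExp_one {G : SimpleGraph V} {x : V} {R : Finset V} {E : SimpleGraph V → Prop}
    (hx : x ∉ R) (hE : ∀ H, G ≤ H → ∀ w ∈ R, H.Adj x w → E H) :
    ∑ v ∈ nbr G x, ((nbr G v ∩ R).card : ℝ) / ((deg G x : ℝ) * deg G v)
      ≤ hopExp 1 (indic E) G := by
  have h0 : hopExp 1 (indic E) G = ∑ c, hopWeight G c * indic E (hopNext G c) := by
    simp only [hopExp]; exact sum_hopStep_mul G _
  by_cases hd : deg G x = 0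
  · have : ∑ v ∈ nbr G x, ((nbr G v ∩ R).card : ℝ) / ((deg G x : ℝ) * deg G v) = 0 := by
      simp [hd]
    rw [this, h0]
    exact Finset.sum_nonneg fun c _ => mul_nonneg (hopWeight_nonneg _ _) (indic_nonneg _ _)
  calc ∑ v ∈ nbr G x, ((nbr G v ∩ R).card : ℝ) / ((deg G x : ℝ) * deg G v)
      = ∑ p, choiceWeight G x p * indic (fun q : V × V => q.2 ∈ R) p := by
        rw [sum_choiceWeight_of_deg_ne_zero hd]
        refine Finset.sum_congr rfl fun v _ => ?_
        rw [← Finset.mul_sum]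
        have h1 : ∑ w ∈ nbr G v, indic (fun q : V × V => q.2 ∈ R) (v, w)
            = ((nbr G v ∩ R).card : ℝ) := by
          rw [← Finset.filter_mem_eq_inter, Finset.card_filter, Nat.cast_sum]
          refine Finset.sum_congr rfl fun w _ => ?_
          by_cases hw : w ∈ R <;> simp [indic, hw]
        rw [h1]
        ring
    _ = ∑ c, hopWeight G c * indic (fun q : V × V => q.2 ∈ R) (c x) :=
        (sum_hopWeight_mul G x _).symm
    _ ≤ hopExp 1 (indic E) G := by
        rw [h0]
        refine Finset.sum_le_sum fun c _ => mul_le_mul_of_nonneg_left ?_ (hopWeight_nonneg _ _)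
        by_cases hc : (c x).2 ∈ R
        · refine (indic_le_one _ _).trans_eq (indic_of (hE _ (le_hopNext G c) _ hc ?_)).symm
          refine Or.inr ?_
          rw [SimpleGraph.fromEdgeSet_adj]
          exact ⟨⟨x, rfl⟩, fun h => hx (h ▸ hc)⟩
        · rw [indic_of_not (E := fun q : V × V => q.2 ∈ R) hc]; exact indic_nonneg _ _

theorem trajProb_hopStep_eq (T : ℕ) (E : SimpleGraph V → Prop) (G : SimpleGraph V) :
    trajProb hopStep G T (fun g => E (g T)) = hopExp T (indic E) G := by
  have key : ∀ (T : ℕ) (f : SimpleGraph V → ℝ) (G : SimpleGraph V),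
      (∑ s : Fin (T + 1) → SimpleGraph V, if s 0 = G then
        (∏ t : Fin T, hopStep (s t.castSucc) (s t.succ)) * f (s (Fin.last T)) else 0)
        = hopExp T f G := by
    intro T f
    induction T with
    | zero =>
      intro G
      rw [← (Equiv.funUnique (Fin 1) (SimpleGraph V)).symm.sum_comp]
      simp [hopExp, Finset.sum_ite_eq']
    | succ T ih =>
      intro G
      rw [← (Fin.consEquiv (fun _ : Fin (T + 2) => SimpleGraph V)).sum_comp,
        Fintype.sum_prod_type, Finset.sum_eq_single G]
      · simp only [hopExp, ← ih, Finset.mul_sum]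
        rw [Finset.sum_comm]
        refine Finset.sum_congr rfl fun s _ => ?_
        rw [Finset.sum_eq_single (s 0)]
        · rw [Fin.prod_univ_succ]
          simp [Fin.consEquiv, ← Fin.succ_last, mul_assoc]
        · intro H _ hH
          rw [if_neg hH.symm, mul_zero]
        · simp
      · intro H _ hH
        refine Finset.sum_eq_zero fun s _ => if_neg ?_
        simpa [Fin.consEquiv] using hH
      · simp
  rw [← key]
  unfold trajProb
  refine Finset.sum_congr rfl fun s _ => ?_
  have hl : s ⟨min T T, Nat.lt_succ_of_le (Nat.min_le_right T T)⟩ = s (Fin.last T) := by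
    congr 1; ext; simp
  simp only [hl, indic]
  by_cases h1 : s 0 = G <;> by_cases h2 : E (s (Fin.last T)) <;> simp [h1, h2]

/-- If most neighbours of each vertex of `U` lie in `W` while `x` has fewer neighbours in `W`, the
walk of `x` discovers a new vertex of `W` at a rate proportional to the number of neighbours of `x`
in `U`. -/
theorem discovery_rate {G : SimpleGraph V} {x : V} {U W : Finset V} {a δ : ℝ} (hδ : 0 < δ)
    (hδn : δ ≤ Fintype.card V) (ha : a ≤ 1) (hW : ((Wᶜ).card : ℝ) ≤ 3 * δ)
    (hx : ((nbr G x ∩ W).card : ℝ) ≤ a * δ)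
    (hU : ∀ y ∈ U, (a + 1 / 16) * δ ≤ ((nbr G y ∩ W).card : ℝ)) :
    1 / (320 * (Fintype.card V : ℝ)) * ((nbr G x ∩ U).card : ℝ) ≤
      ∑ y ∈ nbr G x, ((nbr G y ∩ (W \ nbr G x)).card : ℝ) / ((deg G x : ℝ) * deg G y) := by
  have hdeg : ∀ y, (deg G y : ℝ) ≤ ((nbr G y ∩ W).card : ℝ) + 3 * δ := by
    intro y
    have h1 : deg G y ≤ (nbr G y ∩ W).card + (Wᶜ).card := by
      refine (Finset.card_le_card (t := (nbr G y ∩ W) ∪ Wᶜ) ?_).trans (Finset.card_union_le _ _)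
      intro z hz
      by_cases hzW : z ∈ W <;> simp [hzW, hz]
    have h2 : (deg G y : ℝ) ≤ ((nbr G y ∩ W).card : ℝ) + ((Wᶜ).card : ℝ) := by exact_mod_cast h1
    linarith
  have hterm : ∀ y ∈ nbr G x ∩ U, 1 / (320 * (Fintype.card V : ℝ)) ≤
      ((nbr G y ∩ (W \ nbr G x)).card : ℝ) / ((deg G x : ℝ) * deg G y) := by
    intro y hy
    obtain ⟨hyx, hyU⟩ := Finset.mem_inter.1 hy
    have hxpos : (0 : ℝ) < deg G x := by exact_mod_cast deg_pos_of_adj (mem_nbr.1 hyx)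
    have hypos : (0 : ℝ) < deg G y := by exact_mod_cast deg_pos_of_adj (mem_nbr.1 hyx).symm
    have h1 : (nbr G y ∩ W).card ≤ (nbr G y ∩ (W \ nbr G x)).card + (nbr G x ∩ W).card := by
      refine (Finset.card_le_card ?_).trans (Finset.card_union_le _ _)
      intro z hz
      by_cases hzx : z ∈ nbr G x <;> simp_all
    have h2 : ((nbr G y ∩ W).card : ℝ) ≤
        ((nbr G y ∩ (W \ nbr G x)).card : ℝ) + ((nbr G x ∩ W).card : ℝ) := by exact_mod_cast h1
    have h3 := hU y hyU
    have h4 := hdeg y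
    have h5 := hdeg x
    have haδ : a * δ ≤ 1 * δ := mul_le_mul_of_nonneg_right ha hδ.le
    have h6 : (deg G y : ℝ) ≤ 80 * ((nbr G y ∩ (W \ nbr G x)).card : ℝ) := by linarith
    have h7 : (deg G x : ℝ) ≤ 4 * Fintype.card V := by linarith
    have hn : (0 : ℝ) < Fintype.card V := by linarith
    rw [div_le_div_iff₀ (by positivity) (by positivity)]
    calc 1 * ((deg G x : ℝ) * deg G y)
        ≤ (4 * Fintype.card V) * (80 * ((nbr G y ∩ (W \ nbr G x)).card : ℝ)) := by
          rw [one_mul]; gcongr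
      _ = _ := by ring
  calc 1 / (320 * (Fintype.card V : ℝ)) * ((nbr G x ∩ U).card : ℝ)
      = ∑ y ∈ nbr G x ∩ U, 1 / (320 * (Fintype.card V : ℝ)) := by
        rw [Finset.sum_const, nsmul_eq_mul, mul_comm]
    _ ≤ ∑ y ∈ nbr G x ∩ U, ((nbr G y ∩ (W \ nbr G x)).card : ℝ) / ((deg G x : ℝ) * deg G y) :=
        Finset.sum_le_sum hterm
    _ ≤ _ := Finset.sum_le_sum_of_subset_of_nonneg Finset.inter_subset_left
        fun _ _ _ => by positivity

/-- The bound on the probability that a process with discovery rate `1 / (320 n)` per unit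
survives `t` rounds. -/
noncomputable def survival (V : Type) [Fintype V] (t : ℕ) : ℝ :=
  (1 - 1 / (320 * (Fintype.card V : ℝ)) / 2) ^ t

theorem rate_le_one [Nonempty V] : 1 / (320 * (Fintype.card V : ℝ)) ≤ 1 := by
  have : (1 : ℝ) ≤ Fintype.card V := by exact_mod_cast Fintype.card_pos (α := V)
  rw [div_le_one (by linarith)]; linarith

theorem survival_nonneg [Nonempty V] (t : ℕ) : 0 ≤ survival V t := by
  have := rate_le_one (V := V)
  exact pow_nonneg (by linarith) t

/-- A vertex with many neighbours in the neighbourhood of `u` is discovered quickly. -/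
theorem strongly_tied_bound [Nonempty V] {G₀ : SimpleGraph V} {u w : V} {δ : ℝ} (hδ : 0 < δ)
    (hw : w ≠ u) (hs : δ / 2 ≤ ((nbr G₀ w ∩ nbr G₀ u).card : ℝ)) (t : ℕ) :
    hopExp t (indic fun H => (deg H u : ℝ) < 17 / 16 * δ ∧ w ∉ nbr H u) G₀ ≤ survival V t := by
  have hd := hopExp_indic_decay (Q := fun H => (deg H u : ℝ) < 17 / 16 * δ ∧ w ∉ nbr H u)
    (k := fun _ => 1) (G₀ := G₀) (ρ := 1 / (320 * (Fintype.card V : ℝ))) (N := 1)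
    (by positivity) rate_le_one zero_le_one ?_ (fun _ _ _ => le_rfl) le_rfl (by simp) ?_ t
  · simpa [survival] using hd
  · rintro G H hGH ⟨h1, h2⟩
    exact ⟨lt_of_le_of_lt (by exact_mod_cast deg_mono hGH u) h1, fun h => h2 (nbr_mono hGH u h)⟩
  · rintro G hG ⟨h1, h2⟩
    refine le_trans ?_ (le_hopExp_one (x := u) (R := {w}) (by simpa using hw.symm) ?_)
    · have hn : (0 : ℝ) < Fintype.card V := by exact_mod_cast Fintype.card_pos (α := V)
      have hsub : nbr G₀ w ∩ nbr G₀ u ⊆ nbr G u := fun z hz =>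
        nbr_mono hG u (Finset.mem_inter.1 hz).2
      calc 1 / (320 * (Fintype.card V : ℝ)) * ((1 : ℕ) : ℝ)
          ≤ δ / 2 * (1 / (17 / 16 * δ * Fintype.card V)) := by
            have : δ / 2 * (1 / (17 / 16 * δ * Fintype.card V)) =
                8 / (17 * (Fintype.card V : ℝ)) := by field_simp; norm_num
            rw [this, Nat.cast_one, mul_one, div_le_div_iff₀ (by positivity) (by positivity)]
            linarith
        _ ≤ ((nbr G₀ w ∩ nbr G₀ u).card : ℝ) * (1 / (17 / 16 * δ * Fintype.card V)) :=
            mul_le_mul_of_nonneg_right hs (by positivity)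
        _ = ∑ v ∈ nbr G₀ w ∩ nbr G₀ u, 1 / (17 / 16 * δ * Fintype.card V) := by
            rw [Finset.sum_const, nsmul_eq_mul]
        _ ≤ ∑ v ∈ nbr G₀ w ∩ nbr G₀ u,
              ((nbr G v ∩ {w}).card : ℝ) / ((deg G u : ℝ) * deg G v) := by
            refine Finset.sum_le_sum fun v hv => ?_
            obtain ⟨hvw, hvu⟩ := Finset.mem_inter.1 hv
            have hwv : w ∈ nbr G v := mem_nbr.2 (hG (mem_nbr.1 hvw)).symm
            have hupos : (0 : ℝ) < deg G u := by
              exact_mod_cast deg_pos_of_adj (hG (mem_nbr.1 hvu))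
            have hvpos : (0 : ℝ) < deg G v := by
              exact_mod_cast deg_pos_of_adj (mem_nbr.1 hwv)
            have hvn : (deg G v : ℝ) ≤ Fintype.card V := by
              exact_mod_cast (Nat.le_succ _).trans (deg_lt_card G v)
            rw [Finset.inter_singleton_of_mem hwv, Finset.card_singleton, Nat.cast_one]
            exact one_div_le_one_div_of_le (by positivity)
              (mul_le_mul h1.le hvn hvpos.le (by positivity))
        _ ≤ _ := Finset.sum_le_sum_of_subset_of_nonneg hsub fun _ _ _ => by positivity
    · intro H _ z hz hadj hc
      rw [Finset.mem_singleton] at hz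
      subst hz
      exact hc.1.2 (mem_nbr.2 hadj)

/-- Growth of the number of neighbours of `x` in `U ⊇ W` through vertices of `U`. -/
theorem growth_bound [Nonempty V] {Q : SimpleGraph V → Prop} {G₀ : SimpleGraph V} {x : V}
    {U W : Finset V} {a δ : ℝ} (hδ : 0 < δ) (hδn : δ ≤ Fintype.card V)
    (ha : a ≤ 1) (hW : ((Wᶜ).card : ℝ) ≤ 3 * δ) (hWU : W ⊆ U)
    (hQ : ∀ G H, G ≤ H → Q H → Q G)
    (hx : ∀ G, G₀ ≤ G → Q G → x ∉ W ∧ ((nbr G x ∩ W).card : ℝ) ≤ a * δ)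
    (hU : ∀ y ∈ U, (a + 1 / 16) * δ ≤ ((nbr G₀ y ∩ W).card : ℝ))
    (hk : (nbr G₀ x ∩ U).Nonempty) (t : ℕ) :
    hopExp t (indic Q) G₀ ≤ Fintype.card V * survival V t := by
  refine hopExp_indic_decay (k := fun G => (nbr G x ∩ U).card) (by positivity) rate_le_one
    (by positivity) hQ ?_ (Finset.card_pos.2 hk) ?_ ?_ t
  · exact fun G H h => Finset.card_le_card (Finset.inter_subset_inter_right (nbr_mono h x))
  · exact fun G => by exact_mod_cast Finset.card_le_univ _
  · intro G hG hQG
    obtain ⟨hxW, hxG⟩ := hx G hG hQG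
    refine (discovery_rate hδ hδn ha hW hxG fun y hy => (hU y hy).trans ?_).trans
      (le_hopExp_one (fun h => hxW (Finset.mem_sdiff.1 h).1) ?_)
    · exact_mod_cast Finset.card_le_card (Finset.inter_subset_inter_right (nbr_mono hG y))
    · rintro H hGH w hw hadj ⟨-, hcard⟩
      obtain ⟨hwW, hwG⟩ := Finset.mem_sdiff.1 hw
      refine hcard.not_gt (Finset.card_lt_card ?_)
      refine Finset.ssubset_iff_subset_ne.2
        ⟨Finset.inter_subset_inter_right (nbr_mono hGH x), fun h => ?_⟩
      have : w ∈ nbr H x ∩ U := Finset.mem_inter.2 ⟨mem_nbr.2 hadj, hWU hwW⟩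
      rw [← h] at this
      exact hwG (Finset.mem_inter.1 this).1

/-- A connected graph has an edge leaving the closed neighbourhood of any non-universal vertex. -/
theorem exists_boundary_adj {G : SimpleGraph V} (hG : G.Connected) {u : V}
    (hu : deg G u + 1 < Fintype.card V) :
    ∃ v w, v ∈ nbr G u ∧ w ∉ insert u (nbr G u) ∧ G.Adj v w := by
  obtain ⟨z, hz⟩ : ∃ z, z ∉ insert u (nbr G u) := by
    by_contra! h
    rw [← insert_nbr_card, Finset.eq_univ_of_forall h, Finset.card_univ] at hu
    exact hu.false
  obtain ⟨p⟩ := hG.preconnected u z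
  obtain ⟨d, -, hd1, hd2⟩ := p.exists_boundary_dart (insert u (nbr G u) : Finset V)
    (by simp) (by exact_mod_cast hz)
  rw [Finset.mem_coe] at hd1 hd2
  refine ⟨d.fst, d.snd, ?_, hd2, d.adj⟩
  rcases Finset.mem_insert.1 hd1 with h | h
  · exact absurd (Finset.mem_insert_of_mem (mem_nbr.2 (h ▸ d.adj))) hd2
  · exact h

/-- Starting from minimum degree `δ`, a fixed vertex soon has degree at least `17 / 16 * δ`, or is
adjacent to every other vertex. -/
theorem degree_growth [Nonempty V] {G₀ : SimpleGraph V} (hG₀ : G₀.Connected) {δ : ℝ}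
    (hδ : 1 ≤ δ) (hδn : δ ≤ Fintype.card V) (hdeg : ∀ x, δ ≤ deg G₀ x) (u : V) (t : ℕ) :
    hopExp (t + (t + t))
      (indic fun H => (deg H u : ℝ) < 17 / 16 * δ ∧ deg H u + 1 < Fintype.card V) G₀
      ≤ 3 * Fintype.card V * survival V t := by
  set F : SimpleGraph V → Prop :=
    fun H => (deg H u : ℝ) < 17 / 16 * δ ∧ deg H u + 1 < Fintype.card V
  have hδ0 : 0 < δ := by linarith
  have hlt_mono : ∀ G H : SimpleGraph V, G ≤ H → (deg H u : ℝ) < 17 / 16 * δ →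
      (deg G u : ℝ) < 17 / 16 * δ := fun G H h h1 =>
    lt_of_le_of_lt (by exact_mod_cast deg_mono h u) h1
  have hF_mono : ∀ G H, G ≤ H → F H → F G := fun G H h hF =>
    ⟨hlt_mono G H h hF.1, lt_of_le_of_lt (Nat.succ_le_succ (deg_mono h u)) hF.2⟩
  have hs := survival_nonneg (V := V) t
  have hns : 0 ≤ (Fintype.card V : ℝ) * survival V t := by positivity
  set S : Finset V := Finset.univ.filter fun w =>
    w ∉ insert u (nbr G₀ u) ∧ δ / 2 ≤ ((nbr G₀ w ∩ nbr G₀ u).card : ℝ)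
  have hstage : hopExp t (indic fun H => ∃ w ∈ S, (deg H u : ℝ) < 17 / 16 * δ ∧ w ∉ nbr H u) G₀
      ≤ Fintype.card V * survival V t := by
    refine (hopExp_indic_exists_le (ε := survival V t) fun w hw => ?_).trans
      (mul_le_mul_of_nonneg_right (by exact_mod_cast Finset.card_le_univ S) hs)
    obtain ⟨hw1, hw2⟩ := (Finset.mem_filter.1 hw).2
    exact strongly_tied_bound hδ0 (fun h => hw1 (by simp [h])) hw2 t
  have hrest : ∀ G₁, G₀ ≤ G₁ → ¬ (∃ w ∈ S, (deg G₁ u : ℝ) < 17 / 16 * δ ∧ w ∉ nbr G₁ u) →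
      hopExp (t + t) (indic F) G₁ ≤
        Fintype.card V * survival V t + Fintype.card V * survival V t := by
    intro G₁ hG₁ hS
    by_cases hF₁ : F G₁
    swap
    · exact (hopExp_indic_of_forall_not _ fun H hH h => hF₁ (hF_mono _ _ hH h)).trans
        (by linarith)
    have hSsub : S ⊆ nbr G₁ u := by
      intro w hw
      by_contra h
      exact hS ⟨w, hw, hF₁.1, h⟩
    obtain ⟨v, w, hv, hw, hvw⟩ := exists_boundary_adj (hG₀.mono hG₁) hF₁.2
    set W : Finset V := (insert u (nbr G₀ u ∪ S))ᶜ with hWdef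
    have huW : u ∉ W := by simp [hWdef]
    have hWc : ((Wᶜ).card : ℝ) ≤ 3 * δ := by
      have h1 : (Wᶜ).card ≤ deg G₁ u + 1 := by
        rw [hWdef, compl_compl, ← insert_nbr_card]
        exact Finset.card_le_card
          (Finset.insert_subset_insert u (Finset.union_subset (nbr_mono hG₁ u) hSsub))
      have h2 : ((Wᶜ).card : ℝ) ≤ deg G₁ u + 1 := by exact_mod_cast h1
      linarith [hF₁.1]
    have hScard : (S.card : ℝ) ≤ δ / 16 := by
      have hdisj : Disjoint S (nbr G₀ u) := Finset.disjoint_left.2 fun z hz h =>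
        (Finset.mem_filter.1 hz).2.1 (Finset.mem_insert_of_mem h)
      have h1 : S.card + deg G₀ u ≤ deg G₁ u := by
        unfold deg
        rw [← Finset.card_union_of_disjoint hdisj]
        exact Finset.card_le_card (Finset.union_subset hSsub (nbr_mono hG₁ u))
      have h2 : (S.card : ℝ) + deg G₀ u ≤ deg G₁ u := by exact_mod_cast h1
      linarith [hF₁.1, hdeg u]
    have hweak : ∀ y ∈ W, 7 / 16 * δ ≤ ((nbr G₀ y ∩ W).card : ℝ) := by
      intro y hy
      have hy' : y ≠ u ∧ y ∉ nbr G₀ u ∧ y ∉ S := by simpa [hWdef] using hy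
      have h1 : ((nbr G₀ y ∩ nbr G₀ u).card : ℝ) < δ / 2 := by
        by_contra! h
        refine hy'.2.2 (Finset.mem_filter.2 ⟨Finset.mem_univ _, ?_, h⟩)
        simp [hy'.1, hy'.2.1]
      have h2 : deg G₀ y ≤ (nbr G₀ y ∩ nbr G₀ u).card + S.card + (nbr G₀ y ∩ W).card := by
        refine (Finset.card_le_card (t := (nbr G₀ y ∩ nbr G₀ u ∪ S) ∪ (nbr G₀ y ∩ W)) ?_).trans
          ((Finset.card_union_le _ _).trans
            (Nat.add_le_add_right (Finset.card_union_le _ _) _))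
        intro z hz
        have hzu : z ≠ u := by
          rintro rfl
          exact hy'.2.1 (mem_nbr.2 (mem_nbr.1 hz).symm)
        by_cases h3 : z ∈ nbr G₀ u
        · simp [hz, h3]
        · by_cases h4 : z ∈ S
          · simp [h4]
          · have : z ∈ W := by simp [hWdef, hzu, h3, h4]
            simp [hz, this]
      have h3 : (deg G₀ y : ℝ) ≤
          (nbr G₀ y ∩ nbr G₀ u).card + S.card + (nbr G₀ y ∩ W).card := by exact_mod_cast h2
      linarith [hdeg y]
    have hcard_mono : ∀ {G H : SimpleGraph V} (y : V), G ≤ H →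
        ((nbr G y ∩ W).card : ℝ) ≤ ((nbr H y ∩ W).card : ℝ) := fun y h => by
      exact_mod_cast Finset.card_le_card (Finset.inter_subset_inter_right (nbr_mono h y))
    refine hopExp_indic_comp (E := fun H => (deg H u : ℝ) < 17 / 16 * δ ∧
      (∀ z ∈ nbr H u, z ∉ W) ∧ ((nbr H v ∩ W).card : ℝ) < δ / 8) hns ?_ ?_
    · refine growth_bound (x := v) (U := W) (a := 1 / 8) hδ0 hδn (by norm_num) hWc
        (Finset.Subset.refl _) ?_ ?_ ?_ ?_ t
      · rintro G H h ⟨h1, h2, h3⟩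
        exact ⟨hlt_mono _ _ h h1, fun z hz => h2 z (nbr_mono h u hz),
          (hcard_mono v h).trans_lt h3⟩
      · rintro G hG ⟨h1, h2, h3⟩
        exact ⟨h2 v (nbr_mono hG u hv), by linarith⟩
      · intro y hy
        have := (hweak y hy).trans (hcard_mono y hG₁)
        linarith
      · refine ⟨w, Finset.mem_inter.2 ⟨mem_nbr.2 hvw, ?_⟩⟩
        rw [hWdef, Finset.mem_compl]
        exact fun h => hw (Finset.insert_subset_insert u
          (Finset.union_subset (nbr_mono hG₁ u) hSsub) h)
    · intro G₂ hG₂ hE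
      by_cases hF₂ : F G₂
      swap
      · exact (hopExp_indic_of_forall_not _ fun H hH h => hF₂ (hF_mono _ _ hH h)).trans hns
      have hG₀₂ := hG₁.trans hG₂
      have hWU : ∀ y ∈ W, δ / 8 ≤ ((nbr G₂ y ∩ W).card : ℝ) := fun y hy => by
        have := (hweak y hy).trans (hcard_mono y hG₀₂)
        linarith
      refine growth_bound (x := u) (W := W) (a := 1 / 16)
        (U := Finset.univ.filter fun y => δ / 8 ≤ ((nbr G₂ y ∩ W).card : ℝ))
        hδ0 hδn (by norm_num) hWc ?_ hF_mono ?_ ?_ ?_ t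
      · exact fun y hy => Finset.mem_filter.2 ⟨Finset.mem_univ _, hWU y hy⟩
      · intro G hG hFG
        refine ⟨huW, ?_⟩
        have hdisj : Disjoint (nbr G u ∩ W) (nbr G₀ u) := Finset.disjoint_left.2 fun z hz h => by
          have := (Finset.mem_inter.1 hz).2
          simp [hWdef, h] at this
        have h1 : (nbr G u ∩ W).card + deg G₀ u ≤ deg G u := by
          unfold deg
          rw [← Finset.card_union_of_disjoint hdisj]
          exact Finset.card_le_card
            (Finset.union_subset Finset.inter_subset_left (nbr_mono (hG₀₂.trans hG) u))
        have h2 : ((nbr G u ∩ W).card : ℝ) + deg G₀ u ≤ deg G u := by exact_mod_cast h1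
        linarith [hFG.1, hdeg u]
      · intro y hy
        have := (Finset.mem_filter.1 hy).2
        linarith
      · by_cases h1 : ∀ z ∈ nbr G₂ u, z ∉ W
        · have h2 : δ / 8 ≤ ((nbr G₂ v ∩ W).card : ℝ) := by
            by_contra! h
            exact hE ⟨hF₂.1, h1, h⟩
          exact ⟨v, Finset.mem_inter.2 ⟨nbr_mono hG₂ u hv,
            Finset.mem_filter.2 ⟨Finset.mem_univ _, h2⟩⟩⟩
        · push Not at h1
          obtain ⟨z, hz, hzW⟩ := h1
          exact ⟨z, Finset.mem_inter.2 ⟨hz, Finset.mem_filter.2 ⟨Finset.mem_univ _, hWU z hzW⟩⟩⟩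
  have h := hopExp_indic_comp (by linarith) hstage hrest
  linarith

/-- After `j` phases the minimum degree is at least `(17 / 16) ^ j`, capped at `n - 1`. -/
theorem minimum_degree_growth [Nonempty V] {G₀ : SimpleGraph V} (hG₀ : G₀.Connected) (t j : ℕ) :
    hopExp (j * (t + (t + t))) (indic fun H => ∃ u ∈ (Finset.univ : Finset V),
      (deg H u : ℝ) < (17 / 16) ^ j ∧ deg H u + 1 < Fintype.card V) G₀
      ≤ j * (Fintype.card V * (3 * Fintype.card V * survival V t)) := by
  have hs := survival_nonneg (V := V) t
  induction j with
  | zero =>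
    rw [Nat.zero_mul, Nat.cast_zero, zero_mul]
    refine (indic_of_not ?_).le
    rintro ⟨u, -, h1, h2⟩
    obtain ⟨v, -, hv, -⟩ := exists_boundary_adj hG₀ h2
    have h3 : (1 : ℝ) ≤ deg G₀ u := by exact_mod_cast deg_pos_of_adj (mem_nbr.1 hv)
    rw [pow_zero] at h1
    linarith
  | succ j ih =>
    rw [Nat.succ_mul, Nat.cast_succ, add_one_mul]
    refine hopExp_indic_comp (by positivity) ih fun G hG hE => ?_
    have hE' : ∀ u, deg G u + 1 < Fintype.card V → (17 / 16 : ℝ) ^ j ≤ deg G u := by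
      intro u hu
      by_contra! h
      exact hE ⟨u, Finset.mem_univ _, h, hu⟩
    by_cases hj : (17 / 16 : ℝ) ^ j + 1 ≤ Fintype.card V
    · have hdeg : ∀ u, (17 / 16 : ℝ) ^ j ≤ deg G u := by
        intro u
        by_cases hu : deg G u + 1 < Fintype.card V
        · exact hE' u hu
        · have h1 : (Fintype.card V : ℝ) ≤ deg G u + 1 := by exact_mod_cast not_lt.1 hu
          linarith
      rw [← Finset.card_univ (α := V), pow_succ']
      refine hopExp_indic_exists_le fun u _ => ?_
      exact degree_growth (hG₀.mono hG) (one_le_pow₀ (by norm_num)) (by linarith) hdeg u t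
    · refine (hopExp_indic_of_forall_not _ ?_).trans (by positivity)
      rintro H hH ⟨u, -, -, hu⟩
      have hu' : deg G u + 1 < Fintype.card V :=
        lt_of_le_of_lt (Nat.succ_le_succ (deg_mono hH u)) hu
      have h1 := hE' u hu'
      have h2 : (deg G u : ℝ) + 1 < Fintype.card V := by exact_mod_cast hu'
      exact hj (by linarith)

theorem eq_top_of_deg {G : SimpleGraph V} (h : ∀ u, Fintype.card V ≤ deg G u + 1) : G = ⊤ := by
  refine eq_top_iff.2 fun u v huv => ?_
  have h1 : insert u (nbr G u) = Finset.univ :=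
    Finset.eq_univ_of_card _ (le_antisymm (Finset.card_le_univ _) (by
      rw [insert_nbr_card]; exact h u))
  have h2 : v ∈ insert u (nbr G u) := h1 ▸ Finset.mem_univ v
  exact mem_nbr.1 ((Finset.mem_insert.1 h2).resolve_left fun h => huv h.symm)

theorem one_sub_le_hopExp_top [Nonempty V] {G₀ : SimpleGraph V} (hG₀ : G₀.Connected)
    {t j T : ℕ} (hj : (Fintype.card V : ℝ) ≤ (17 / 16) ^ j) (hT : j * (t + (t + t)) ≤ T) :
    1 - j * (Fintype.card V * (3 * Fintype.card V * survival V t))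
      ≤ hopExp T (indic fun H => H = ⊤) G₀ := by
  obtain ⟨r, rfl⟩ := Nat.exists_eq_add_of_le hT
  have h1 : hopExp (j * (t + (t + t)) + r) (indic fun H => H ≠ ⊤) G₀ ≤
      j * (Fintype.card V * (3 * Fintype.card V * survival V t)) + 0 := by
    refine hopExp_indic_comp le_rfl (minimum_degree_growth hG₀ t j) fun G _ hE => ?_
    refine hopExp_indic_of_forall_not _ fun H hH hne => hne (top_le_iff.1 ?_)
    refine (eq_top_of_deg fun u => ?_).symm.le.trans hH
    by_contra! hu
    refine hE ⟨u, Finset.mem_univ _, lt_of_lt_of_le ?_ hj, hu⟩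
    exact_mod_cast (Nat.lt_succ_self _).trans hu
  have h2 : hopExp (j * (t + (t + t)) + r) (fun H => indic (fun H => H = ⊤) H +
      indic (fun H => H ≠ ⊤) H) G₀ = 1 := by
    rw [← hopExp_const (j * (t + (t + t)) + r) 1 G₀]
    congr 1
    ext H
    by_cases h : H = ⊤ <;> simp [indic, h]
  rw [hopExp_add_fun] at h2
  linarith

theorem survival_le [Nonempty V] {t : ℕ}
    (ht : 1920 * Fintype.card V * Real.log (Fintype.card V) ≤ t) :
    survival V t ≤ 1 / (Fintype.card V : ℝ) ^ 3 := by
  have hn : (0 : ℝ) < Fintype.card V := by exact_mod_cast Fintype.card_pos (α := V)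
  have h1 : 0 ≤ 1 - 1 / (320 * (Fintype.card V : ℝ)) / 2 := by
    have := rate_le_one (V := V)
    linarith
  calc survival V t ≤ Real.exp (-(1 / (320 * (Fintype.card V : ℝ)) / 2)) ^ t :=
        pow_le_pow_left₀ h1 (Real.one_sub_le_exp_neg _) t
    _ = Real.exp (-(t / (640 * (Fintype.card V : ℝ)))) := by
        rw [← Real.exp_nat_mul]
        congr 1
        field_simp
        ring
    _ ≤ Real.exp (-(3 * Real.log (Fintype.card V))) := by
        refine Real.exp_le_exp.2 (neg_le_neg ?_)
        rw [le_div_iff₀ (by positivity)]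
        linarith
    _ = 1 / (Fintype.card V : ℝ) ^ 3 := by
        rw [Real.exp_neg, one_div]
        congr 1
        rw [← Real.exp_log hn, Real.log_exp, ← Real.exp_nat_mul]
        norm_num

end

/-- There are constants `C > 0` and `C' > 0` such that for every
`n ≥ 2` and every connected initial graph `G₀` on `n` vertices, after
`T = ⌈C·n·(ln n)²⌉` rounds of the two-hop walk process, the graph `G_T` is the complete
graph with probability at least `1 − C'·(ln n)/n`. -/
theorem twoHop_upper_bound :
    ∃ C : ℝ, 0 < C ∧ ∃ C' : ℝ, 0 < C' ∧
      ∀ (V : Type) [Fintype V] [DecidableEq V] (n : ℕ), 2 ≤ n → Fintype.card V = n →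
        ∀ (G0 : SimpleGraph V), G0.Connected →
          ∀ T : ℕ, T = ⌈C * n * (Real.log n) ^ 2⌉₊ →
            1 - C' * Real.log n / n ≤
              trajProb hopStep G0 T (fun g => g T = (⊤ : SimpleGraph V)) := by
  refine ⟨110000, by norm_num, 57, by norm_num, ?_⟩
  intro V _ _ n hn hcard G₀ hG₀ T hT
  subst hcard
  have : Nonempty V := hG₀.nonempty
  rw [trajProb_hopStep_eq T (fun G => G = ⊤) G₀]
  set n : ℝ := (Fintype.card V : ℝ) with hndef
  have hn2 : (2 : ℝ) ≤ n := by rw [hndef]; exact_mod_cast hn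
  have hn0 : 0 < n := by linarith
  set ℓ := Real.log n with hℓ
  have hℓ2 : 1 / 2 ≤ ℓ := by
    have h1 : Real.log 2 ≤ ℓ := Real.log_le_log (by norm_num) hn2
    linarith [Real.log_two_gt_d9]
  set j := ⌈17 * ℓ⌉₊
  set t := ⌈1920 * n * ℓ⌉₊
  have hj : (j : ℝ) ≤ 19 * ℓ := by
    have := Nat.ceil_lt_add_one (a := 17 * ℓ) (by linarith)
    linarith
  have hnℓ : 1 ≤ n * ℓ := by nlinarith
  have ht : (t : ℝ) ≤ 1921 * n * ℓ := by
    have := Nat.ceil_lt_add_one (a := 1920 * n * ℓ) (by nlinarith)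
    linarith
  have hpow : n ≤ (17 / 16) ^ j := by
    have h1 : 1 / 17 ≤ Real.log (17 / 16) := by
      have := Real.one_sub_inv_le_log_of_pos (x := 17 / 16) (by norm_num)
      norm_num at this ⊢
      exact this
    rw [← Real.log_le_log_iff hn0 (by positivity), Real.log_pow]
    have h2 : 17 * ℓ ≤ j := Nat.le_ceil _
    nlinarith [Nat.cast_nonneg (α := ℝ) j]
  have hle : j * (t + (t + t)) ≤ T := by
    have h1 : (j : ℝ) * (t + (t + t)) ≤ T := by
      calc (j : ℝ) * (t + (t + t)) ≤ (19 * ℓ) * (3 * (1921 * n * ℓ)) := by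
            refine mul_le_mul hj (by linarith) (by positivity) (by linarith)
        _ ≤ 110000 * n * ℓ ^ 2 := by
            have : 0 ≤ n * ℓ ^ 2 := by positivity
            linarith
        _ ≤ T := hT ▸ Nat.le_ceil _
    exact_mod_cast h1
  refine le_trans ?_ (one_sub_le_hopExp_top hG₀ hpow hle)
  have hs : survival V t ≤ 1 / n ^ 3 := survival_le (Nat.le_ceil _)
  have h1 : (j : ℝ) * (n * (3 * n * survival V t)) ≤ 57 * ℓ / n := by
    calc (j : ℝ) * (n * (3 * n * survival V t)) ≤ (19 * ℓ) * (n * (3 * n * (1 / n ^ 3))) := by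
          refine mul_le_mul hj (by gcongr) ?_ (by linarith)
          have := survival_nonneg (V := V) t
          positivity
      _ = 57 * ℓ / n := by field_simp; norm_num
  linarith
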